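/- The generating function f_∞ of the strong-coupling Stokes constants of local ℙ² is a holomorphic quantum modular function of weight zero for Γ₁(3): (i) f_∞(y+1) = f_∞(y) for every y in the upper half-plane ℍ (the cocycle of the generator T is trivial), and (ii) there exists a function h : ℂ → ℂ that is complex-differentiable on ℂ ∖ ℝ_{≤0} and satisfies h(y) = f_∞(y/(3y+1)) − f_∞(y) for every y ∈ ℍ (the cocycle of the generator γ₃ = [[1,0],[3,1]] extends holomorphically to the cut plane). -/

import Mathlib

open scoped Real

noncomputable section

/-- The nonprincipal Dirichlet character modulo 3. -/
def chi (n : ℤ) : ℤ := if n % 3 = 1 then 1 else if n % 3 = 2 then -1 else 0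

/-- The weak-coupling Stokes constants of local ℙ². -/
def S (n : ℕ) : ℂ := 3 * Real.sqrt 3 * Complex.I * ∑ d ∈ n.divisors, (chi d : ℂ) / d

/-- The strong-coupling Stokes constants of local ℙ². -/
def R (n : ℕ) : ℂ := 3 * ∑ d ∈ n.divisors, (chi d : ℂ) * d / n

/-- The generating function of the weak-coupling Stokes constants on the upper half-plane. -/
def f0 (y : ℂ) : ℂ := ∑' n : ℕ, S (n + 1) * Complex.exp (2 * π * Complex.I * (n + 1) * y)

/-- The generating function of the strong-coupling Stokes constants on the upper half-plane. -/
def finf (y : ℂ) : ℂ := ∑' n : ℕ, R (n + 1) * Complex.exp (2 * π * Complex.I * (n + 1) * y)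

open Complex Filter Topology in
/-- Points of the slit plane have a neighbourhood on which linear forms with nonnegative
coefficients are uniformly bounded below. -/
lemma exists_eventually_le_norm_add_mul {w : ℂ} (hw : w ∈ Complex.slitPlane) :
    ∃ c > 0, ∀ᶠ z in 𝓝 w, ∀ a b : ℝ, 0 ≤ a → 0 ≤ b → c * (a + b) ≤ ‖(a : ℂ) + b * z‖ := by
  have hcont : ContinuousOn (fun t : ℝ => ‖(1 : ℂ) + t * (w - 1)‖) (Set.Icc 0 1) := by fun_prop
  obtain ⟨t₀, ht₀, hmin⟩ := isCompact_Icc.exists_isMinOn (by simp) hcont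
  set c := ‖(1 : ℂ) + t₀ * (w - 1)‖
  have hc : 0 < c := by
    have hmem := StarConvex.add_smul_mem (x := (1 : ℂ)) (y := w - 1)
      starConvex_one_slitPlane (by simpa using hw) ht₀.1 ht₀.2
    exact norm_pos_iff.mpr (by simpa using slitPlane_ne_zero hmem)
  have hbase (a b : ℝ) (ha : 0 ≤ a) (hb : 0 ≤ b) : c * (a + b) ≤ ‖(a : ℂ) + b * w‖ := by
    rcases (add_nonneg ha hb).eq_or_lt with h | h
    · simp [← h]
    have hle : c ≤ ‖(1 : ℂ) + ((b / (a + b) : ℝ) : ℂ) * (w - 1)‖ :=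
      hmin ⟨by positivity, by rw [div_le_one h]; linarith⟩
    have h0 : (a : ℂ) + b ≠ 0 := by exact_mod_cast h.ne'
    have heq : (a : ℂ) + b * w =
        (1 + ((b / (a + b) : ℝ) : ℂ) * (w - 1)) * ((a + b : ℝ) : ℂ) := by
      push_cast
      field_simp
      ring
    rw [heq, norm_mul, norm_real, Real.norm_of_nonneg h.le]
    gcongr
  refine ⟨c / 2, by positivity, ?_⟩
  filter_upwards [Metric.ball_mem_nhds w (half_pos hc)] with z hz a b ha hb
  rw [Metric.mem_ball, dist_comm, dist_eq_norm] at hz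
  have h1 : ‖(a : ℂ) + b * w‖ ≤ ‖(a : ℂ) + b * z‖ + b * ‖w - z‖ := by
    have : (a : ℂ) + b * w = (a + b * z) + b * (w - z) := by ring
    rw [this]
    refine (norm_add_le _ _).trans ?_
    rw [norm_mul, norm_real, Real.norm_of_nonneg hb]
  nlinarith [hbase a b ha hb]

open Complex Filter Topology in
/-- A locally dominated series of functions holomorphic on an open set is holomorphic. -/
lemma differentiableOn_tsum_of_locally_summable {ι : Type*} {F : ι → ℂ → ℂ} {s : Set ℂ}
    (hs : IsOpen s) (hF : ∀ i, DifferentiableOn ℂ (F i) s)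
    (hb : ∀ w ∈ s, ∃ u : ι → ℝ, Summable u ∧ ∀ᶠ z in 𝓝 w, ∀ i, ‖F i z‖ ≤ u i) :
    DifferentiableOn ℂ (fun z => ∑' i, F i z) s := by
  intro w hw
  obtain ⟨u, hu, hle⟩ := hb w hw
  obtain ⟨V, hV, hVo, hwV⟩ := eventually_nhds_iff.mp (hle.and (hs.eventually_mem hw))
  have hd : DifferentiableOn ℂ (fun z => ∑' i, F i z) V :=
    differentiableOn_tsum_of_summable_norm hu
      (fun i => (hF i).mono fun z hz => (hV z hz).2) hVo fun i z hz => (hV z hz).1 i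
  exact (hd.differentiableAt (hVo.mem_nhds hwV)).differentiableWithinAt

/-- The summand of the double series whose reflection-symmetric part is `finf`. -/
def doubleTerm (w : ℂ) (p : ℕ × ℕ) : ℂ :=
  (1 / (3 * p.2 + 1 + 3 * ((p.1 + 1) * w)) - 1 / (3 * p.2 + 2 + 3 * ((p.1 + 1) * w))) / (p.1 + 1)

lemma ofReal_add_mul_ne_zero {w : ℂ} (hw : w ∈ Complex.slitPlane) {a b : ℝ} (ha : 0 < a)
    (hb : 0 ≤ b) : (a : ℂ) + b * w ≠ 0 := by
  obtain ⟨c, hc, h⟩ := exists_eventually_le_norm_add_mul hw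
  have := h.self_of_nhds a b ha.le hb
  exact norm_pos_iff.mp (lt_of_lt_of_le (by positivity) this)

lemma norm_doubleTerm_le {w : ℂ} {c : ℝ} (hc : 0 < c)
    (h : ∀ a b : ℝ, 0 ≤ a → 0 ≤ b → c * (a + b) ≤ ‖(a : ℂ) + b * w‖) (p : ℕ × ℕ) :
    ‖doubleTerm w p‖ ≤
      (c ^ 2)⁻¹ * (((p.1 + 1 : ℕ) : ℝ) ^ (3 / 2 : ℝ))⁻¹ * (((p.2 + 1 : ℕ) : ℝ) ^ (3 / 2 : ℝ))⁻¹ := by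
  obtain ⟨k, j⟩ := p
  set A : ℂ := 3 * j + 1 + 3 * ((k + 1) * w) with hA
  set B : ℂ := 3 * j + 2 + 3 * ((k + 1) * w) with hB
  set a : ℝ := ((j + 1 : ℕ) : ℝ) with ha
  set b : ℝ := ((k + 1 : ℕ) : ℝ) with hb
  have ha1 : 0 < a := by rw [ha]; positivity
  have hb1 : 0 < b := by rw [hb]; positivity
  have hjk : (j : ℝ) + 1 = a ∧ (k : ℝ) + 1 = b := by simp [ha, hb]
  have hAn : c * (a + b) ≤ ‖A‖ := by
    have := h (3 * j + 1) (3 * (k + 1)) (by positivity) (by positivity)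
    have e : ((3 * j + 1 : ℝ) : ℂ) + ((3 * (k + 1) : ℝ) : ℂ) * w = A := by
      rw [hA]; push_cast; ring
    rw [e] at this
    refine le_trans (mul_le_mul_of_nonneg_left ?_ hc.le) this
    rw [← hjk.1, ← hjk.2]
    linarith [(Nat.cast_nonneg j : (0 : ℝ) ≤ j), (Nat.cast_nonneg k : (0 : ℝ) ≤ k)]
  have hBn : c * (a + b) ≤ ‖B‖ := by
    have := h (3 * j + 2) (3 * (k + 1)) (by positivity) (by positivity)
    have e : ((3 * j + 2 : ℝ) : ℂ) + ((3 * (k + 1) : ℝ) : ℂ) * w = B := by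
      rw [hB]; push_cast; ring
    rw [e] at this
    refine le_trans (mul_le_mul_of_nonneg_left ?_ hc.le) this
    rw [← hjk.1, ← hjk.2]
    linarith [(Nat.cast_nonneg j : (0 : ℝ) ≤ j), (Nat.cast_nonneg k : (0 : ℝ) ≤ k)]
  have hcab : 0 < c * (a + b) := by positivity
  have hA0 : A ≠ 0 := norm_pos_iff.mp (hcab.trans_le hAn)
  have hB0 : B ≠ 0 := norm_pos_iff.mp (hcab.trans_le hBn)
  have hk0 : (k : ℂ) + 1 ≠ 0 := by exact_mod_cast k.succ_ne_zero
  have e : doubleTerm w (k, j) = (A * B * (k + 1))⁻¹ := by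
    have : doubleTerm w (k, j) = (1 / A - 1 / B) / (k + 1) := rfl
    rw [this]
    field_simp
    rw [hA, hB]; ring
  have hkn : ‖(k : ℂ) + 1‖ = b := by
    rw [← Nat.cast_succ, Complex.norm_natCast]
  have e32 (x : ℝ) (hx : 0 < x) : x ^ (3 / 2 : ℝ) = x * √x := by
    rw [show (3 / 2 : ℝ) = 1 + 1 / 2 by norm_num, Real.rpow_add hx, Real.rpow_one,
      Real.sqrt_eq_rpow]
  rw [e, norm_inv, norm_mul, norm_mul, hkn, e32 _ ha1, e32 _ hb1, ← mul_inv, ← mul_inv]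
  apply inv_anti₀ (by positivity)
  have hs : √a * √b ≤ a + b := by
    nlinarith [Real.sq_sqrt ha1.le, Real.sq_sqrt hb1.le, sq_nonneg (√a - √b)]
  calc c ^ 2 * (b * √b) * (a * √a) = c ^ 2 * b * (a * (√a * √b)) := by ring
    _ ≤ c ^ 2 * b * ((a + b) * (a + b)) := by
      gcongr
      linarith
    _ = (c * (a + b)) * (c * (a + b)) * b := by ring
    _ ≤ ‖A‖ * ‖B‖ * b := by gcongr

lemma summable_doubleTerm_bound (C : ℝ) : Summable fun p : ℕ × ℕ =>
    C * (((p.1 + 1 : ℕ) : ℝ) ^ (3 / 2 : ℝ))⁻¹ * (((p.2 + 1 : ℕ) : ℝ) ^ (3 / 2 : ℝ))⁻¹ := by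
  have h : Summable fun n : ℕ => (((n + 1 : ℕ) : ℝ) ^ (3 / 2 : ℝ))⁻¹ :=
    (summable_nat_add_iff 1).mpr (Real.summable_nat_rpow_inv.mpr (by norm_num : (1 : ℝ) < 3 / 2))
  simpa [mul_assoc] using
    (h.mul_of_nonneg h (fun _ => by positivity) (fun _ => by positivity)).mul_left C

lemma summable_doubleTerm {w : ℂ} (hw : w ∈ Complex.slitPlane) : Summable (doubleTerm w) := by
  obtain ⟨c, hc, h⟩ := exists_eventually_le_norm_add_mul hw
  exact .of_norm_bounded (summable_doubleTerm_bound _) (norm_doubleTerm_le hc h.self_of_nhds)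

lemma differentiableOn_tsum_doubleTerm :
    DifferentiableOn ℂ (fun w => ∑' p, doubleTerm w p) Complex.slitPlane := by
  refine differentiableOn_tsum_of_locally_summable Complex.isOpen_slitPlane
    (F := fun p w => doubleTerm w p) (fun p w hw => ?_) fun w hw => ?_
  · have h1 := ofReal_add_mul_ne_zero hw (a := 3 * p.2 + 1) (b := 3 * (p.1 + 1))
      (by positivity) (by positivity)
    have h2 := ofReal_add_mul_ne_zero hw (a := 3 * p.2 + 2) (b := 3 * (p.1 + 1))
      (by positivity) (by positivity)
    push_cast [mul_assoc] at h1 h2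
    unfold doubleTerm
    apply DifferentiableAt.differentiableWithinAt
    fun_prop (disch := assumption)
  · obtain ⟨c, hc, h⟩ := exists_eventually_le_norm_add_mul hw
    exact ⟨_, summable_doubleTerm_bound (c ^ 2)⁻¹, h.mono fun z hz => norm_doubleTerm_le hc hz⟩

/-- The averages of `1 / (m + 3 i y)` over `i < m`. -/
def sectorMean (y : ℂ) (m : ℕ) : ℂ := 1 / m * ∑ i ∈ Finset.range m, 1 / ((m : ℂ) + 3 * i * y)

lemma norm_sectorMean_sub_succ_le {y : ℂ} {c : ℝ} (hc : 0 < c)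
    (h : ∀ a b : ℝ, 0 ≤ a → 0 ≤ b → c * (a + b) ≤ ‖(a : ℂ) + b * y‖) {m : ℕ} (hm : 0 < m) :
    ‖sectorMean y m - sectorMean y (m + 1)‖ ≤ ((c ^ 2)⁻¹ + 2 * c⁻¹) / (m : ℝ) ^ 2 := by
  have hm' : (0 : ℝ) < m := by exact_mod_cast hm
  have hlow (i : ℕ) (l : ℕ) (hl : m ≤ l) : c * m ≤ ‖(l : ℂ) + 3 * i * y‖ := by
    have := h l (3 * i) (by positivity) (by positivity)
    push_cast at this
    have hl' : (m : ℝ) ≤ l := by exact_mod_cast hl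
    exact le_trans (mul_le_mul_of_nonneg_left
      (by linarith [(Nat.cast_nonneg i : (0 : ℝ) ≤ i)]) hc.le) this
  have hcm : 0 < c * m := by positivity
  have hne (i : ℕ) (l : ℕ) (hl : m ≤ l) : (l : ℂ) + 3 * i * y ≠ 0 :=
    norm_pos_iff.mp (hcm.trans_le (hlow i l hl))
  have hinv (i : ℕ) (l : ℕ) (hl : m ≤ l) : ‖((l : ℂ) + 3 * i * y)⁻¹‖ ≤ (c * m)⁻¹ := by
    rw [norm_inv]
    exact inv_anti₀ hcm (hlow i l hl)
  have hm1 : ‖((m + 1 : ℕ) : ℂ)⁻¹‖ ≤ (m : ℝ)⁻¹ := by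
    rw [norm_inv, Complex.norm_natCast]
    exact inv_anti₀ hm' (by simp)
  have hm0 : ‖(m : ℂ)⁻¹‖ = (m : ℝ)⁻¹ := by rw [norm_inv, Complex.norm_natCast]
  have hmc : (m : ℂ) ≠ 0 := by exact_mod_cast hm.ne'
  have hmc1 : ((m + 1 : ℕ) : ℂ) ≠ 0 := by exact_mod_cast m.succ_ne_zero
  have heq : sectorMean y m - sectorMean y (m + 1) =
      ∑ i ∈ Finset.range m, (((m + 1 : ℕ) : ℂ)⁻¹ * ((m : ℂ) + 3 * i * y)⁻¹ *
          (((m + 1 : ℕ) : ℂ) + 3 * i * y)⁻¹ +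
        (m : ℂ)⁻¹ * ((m + 1 : ℕ) : ℂ)⁻¹ * ((m : ℂ) + 3 * i * y)⁻¹) -
      ((m + 1 : ℕ) : ℂ)⁻¹ * (((m + 1 : ℕ) : ℂ) + 3 * m * y)⁻¹ := by
    simp only [sectorMean]
    rw [Finset.sum_range_succ, mul_add, ← sub_sub, Finset.mul_sum, Finset.mul_sum,
      ← Finset.sum_sub_distrib]
    congr 1
    · refine Finset.sum_congr rfl fun i _ => ?_
      have h1 := hne i m le_rfl
      have h2 := hne i (m + 1) (Nat.le_succ m)
      field_simp
      push_cast
      ring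
    · simp
  have hterm (i : ℕ) : ‖((m + 1 : ℕ) : ℂ)⁻¹ * ((m : ℂ) + 3 * i * y)⁻¹ *
          (((m + 1 : ℕ) : ℂ) + 3 * i * y)⁻¹ +
        (m : ℂ)⁻¹ * ((m + 1 : ℕ) : ℂ)⁻¹ * ((m : ℂ) + 3 * i * y)⁻¹‖ ≤
      (m : ℝ)⁻¹ * (c * m)⁻¹ * (c * m)⁻¹ + (m : ℝ)⁻¹ * (m : ℝ)⁻¹ * (c * m)⁻¹ := by
    refine (norm_add_le _ _).trans ?_
    simp only [norm_mul, hm0]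
    have h1 := hinv i m le_rfl
    have h2 := hinv i (m + 1) (Nat.le_succ m)
    gcongr
  rw [heq]
  refine (norm_sub_le _ _).trans ((add_le_add (norm_sum_le_of_le _ fun i _ => hterm i)
    (?_ : _ ≤ (m : ℝ)⁻¹ * (c * m)⁻¹)).trans_eq ?_)
  · rw [norm_mul]
    exact mul_le_mul hm1 (hinv m (m + 1) (Nat.le_succ m)) (norm_nonneg _) (by positivity)
  · rw [Finset.sum_const, Finset.card_range, nsmul_eq_mul]
    field_simp
    ring

/-- The correction series appearing in the translation of the double series. -/
def sectorTerm (y : ℂ) (j : ℕ) : ℂ := sectorMean y (3 * j + 1) - sectorMean y (3 * j + 2)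

open Filter Topology in
lemma differentiableOn_tsum_sectorTerm :
    DifferentiableOn ℂ (fun y => ∑' j, sectorTerm y j) Complex.slitPlane := by
  refine differentiableOn_tsum_of_locally_summable Complex.isOpen_slitPlane
    (F := fun j y => sectorTerm y j) (fun j y hy => ?_) fun y hy => ?_
  · have hd (m : ℕ) : DifferentiableAt ℂ (fun y => sectorMean y (m + 1)) y := by
      unfold sectorMean
      refine DifferentiableAt.const_mul (DifferentiableAt.fun_sum fun i _ => ?_) _
      have h1 := ofReal_add_mul_ne_zero hy (a := (m + 1 : ℕ)) (b := 3 * i)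
        (by positivity) (by positivity)
      push_cast at h1 ⊢
      fun_prop (disch := assumption)
    exact ((hd _).sub (hd _)).differentiableWithinAt
  · obtain ⟨c, hc, h⟩ := exists_eventually_le_norm_add_mul hy
    refine ⟨fun j => ((c ^ 2)⁻¹ + 2 * c⁻¹) / ((j + 1 : ℕ) : ℝ) ^ 2, ?_, h.mono fun z hz j => ?_⟩
    · have := (summable_nat_add_iff 1).mpr (Real.summable_one_div_nat_pow.mpr one_lt_two)
      simpa [div_eq_mul_inv] using this.mul_left ((c ^ 2)⁻¹ + 2 * c⁻¹)
    · refine (norm_sectorMean_sub_succ_le hc hz (m := 3 * j + 1) (by positivity)).trans ?_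
      have hj : ((j + 1 : ℕ) : ℝ) ≤ (3 * j + 1 : ℕ) := by exact_mod_cast (by omega)
      exact div_le_div_of_nonneg_left (by positivity) (by positivity) (by gcongr)

open Filter Topology Bornology in
lemma tendsto_const_div_add_natCast_mul (a b : ℂ) {d : ℂ} (hd : d ≠ 0) :
    Tendsto (fun n : ℕ => a / (b + n * d)) atTop (𝓝 0) := by
  have h1 : Tendsto (fun n : ℕ => (n : ℂ)) atTop (cobounded ℂ) :=
    tendsto_natCast_atTop_cobounded
  have h2 : Tendsto (fun n : ℕ => ‖(n : ℂ) * d‖ - ‖b‖) atTop atTop := by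
    simp only [norm_mul, Complex.norm_natCast]
    exact tendsto_atTop_add_const_right _ _
      (tendsto_natCast_atTop_atTop.atTop_mul_const (norm_pos_iff.mpr hd))
  have h3 : Tendsto (fun n : ℕ => b + n * d) atTop (cobounded ℂ) := by
    refine tendsto_norm_atTop_iff_cobounded.mp (tendsto_atTop_mono (fun n => ?_) h2)
    have := norm_sub_norm_le ((n : ℂ) * d) (-b)
    rwa [norm_neg, sub_neg_eq_add, add_comm ((n : ℂ) * d)] at this
  simpa [div_eq_mul_inv] using (tendsto_inv₀_cobounded.comp h3).const_mul a

open Filter Topology in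
lemma tendsto_sum_range_sub_shift {b : ℕ → ℂ} (hb : Tendsto b atTop (𝓝 0)) (m : ℕ) :
    Tendsto (fun N => ∑ k ∈ Finset.range N, (b (k + m) - b k)) atTop
      (𝓝 (-∑ i ∈ Finset.range m, b i)) := by
  have h (N : ℕ) : ∑ k ∈ Finset.range N, (b (k + m) - b k) =
      ∑ i ∈ Finset.range m, b (i + N) - ∑ i ∈ Finset.range m, b i := by
    rw [Finset.sum_sub_distrib]
    have h1 := Finset.sum_range_add b N m
    have h2 := Finset.sum_range_add b m N
    rw [add_comm m N, h1] at h2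
    simp only [add_comm _ m, add_comm _ N]
    linear_combination -h2
  simp only [h]
  have : Tendsto (fun N => ∑ i ∈ Finset.range m, b (i + N)) atTop (𝓝 0) := by
    simpa using tendsto_finsetSum (Finset.range m) fun i _ =>
      hb.comp (tendsto_add_atTop_nat i |>.congr fun n => add_comm n i)
  simpa using this.sub_const _

lemma add_mul_ne_zero_of_im_ne_zero {y : ℂ} (hy : y.im ≠ 0) {a : ℝ} (ha : a ≠ 0) (b : ℝ) :
    (a : ℂ) + b * y ≠ 0 := by
  intro h
  have him := congrArg Complex.im h
  have hb : b = 0 := by simpa [hy] using him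
  simp [hb, ha] at h

open Filter Topology in
lemma tendsto_sum_range_shift {y : ℂ} (hy : y.im ≠ 0) {m : ℕ} (hm : 0 < m) :
    Tendsto (fun N => ∑ k ∈ Finset.range N,
      (1 / ((m : ℂ) + 3 * ((k + 1) * -(y / (3 * y + 1)))) / (k + 1) -
        1 / ((m : ℂ) + 3 * ((k + 1) * -y)) / (k + 1))) atTop (𝓝 (3 * y * sectorMean y m)) := by
  have hm0 : (m : ℂ) ≠ 0 := by exact_mod_cast hm.ne'
  have hy0 : y ≠ 0 := by rintro rfl; simp at hy
  set b : ℕ → ℂ := fun k => -3 * y / ((m + 3 * (m - 1) * y) + k * (-3 * y)) with hb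
  have hlim := tendsto_sum_range_sub_shift
    (tendsto_const_div_add_natCast_mul (-3 * y) (m + 3 * (m - 1) * y)
      (d := -3 * y) (mul_ne_zero (by norm_num) hy0)) m
  convert hlim.const_mul (1 / (m : ℂ)) using 1
  · funext N
    rw [Finset.mul_sum]
    refine Finset.sum_congr rfl fun k _ => ?_
    have h1 : (1 : ℂ) + 3 * y ≠ 0 := by
      simpa using add_mul_ne_zero_of_im_ne_zero hy one_ne_zero 3
    have h2 := add_mul_ne_zero_of_im_ne_zero hy (a := m) (by positivity) (-3 * (k + 1))
    have h3 := add_mul_ne_zero_of_im_ne_zero hy (a := m) (by positivity) (3 * m - 3 * (k + 1))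
    push_cast at h2 h3
    have hk : (k : ℂ) + 1 ≠ 0 := by exact_mod_cast k.succ_ne_zero
    have e1 : (m : ℂ) + 3 * ((k + 1) * -(y / (3 * y + 1))) =
        (m + (3 * m - 3 * (k + 1)) * y) / (1 + 3 * y) := by
      rw [add_comm (3 * y)]
      field_simp
      ring
    have e2 : (m : ℂ) + 3 * ((k + 1) * -y) = m + -3 * (k + 1) * y := by ring
    have e3 : (m : ℂ) + 3 * (m - 1) * y + ((k + m : ℕ) : ℂ) * (-3 * y) =
        m + -3 * (k + 1) * y := by push_cast; ring
    have e4 : (m : ℂ) + 3 * (m - 1) * y + k * (-3 * y) =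
        m + (3 * m - 3 * (k + 1)) * y := by ring
    rw [e1, e2, e3, e4]
    generalize hP : (m : ℂ) + -3 * (k + 1) * y = P at h2 ⊢
    generalize hQ : (m : ℂ) + (3 * m - 3 * (k + 1)) * y = Q at h3 ⊢
    field_simp
    rw [← hP, ← hQ]
    ring
  · congr 1
    rw [sectorMean, ← Finset.sum_range_reflect, ← Finset.sum_neg_distrib, Finset.mul_sum,
      Finset.mul_sum, Finset.mul_sum]
    refine Finset.sum_congr rfl fun i hi => ?_
    have hi' : 1 + i ≤ m := by rw [add_comm]; exact Finset.mem_range.mp hi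
    rw [Nat.sub_sub, Nat.cast_sub hi']
    have e : (m : ℂ) + 3 * (m - 1) * y + i * (-3 * y) = m + 3 * (m - (1 + i)) * y := by ring
    push_cast
    rw [e]
    ring

lemma mem_slitPlane_of_im_ne_zero {y : ℂ} (hy : y.im ≠ 0) : y ∈ Complex.slitPlane :=
  Complex.mem_slitPlane_iff.mpr (Or.inr hy)

lemma im_div_three_mul_add_one (y : ℂ) :
    (y / (3 * y + 1)).im = y.im / Complex.normSq (3 * y + 1) := by
  rw [Complex.div_im]
  simp
  ring

lemma im_div_three_mul_add_one_ne_zero {y : ℂ} (hy : y.im ≠ 0) : (y / (3 * y + 1)).im ≠ 0 := by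
  have h : (3 : ℂ) * y + 1 ≠ 0 := by
    simpa [add_comm] using add_mul_ne_zero_of_im_ne_zero hy one_ne_zero 3
  rw [im_div_three_mul_add_one]
  exact div_ne_zero hy (Complex.normSq_pos.mpr h).ne'

open Filter Topology in
lemma tsum_doubleTerm_neg_sub {y : ℂ} (hy : y.im ≠ 0) :
    ∑' p, doubleTerm (-(y / (3 * y + 1))) p - ∑' p, doubleTerm (-y) p =
      3 * y * ∑' j, sectorTerm y j := by
  have s1 : Summable (doubleTerm (-(y / (3 * y + 1)))) := summable_doubleTerm <|
    mem_slitPlane_of_im_ne_zero (by simpa using im_div_three_mul_add_one_ne_zero hy)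
  have s2 : Summable (doubleTerm (-y)) := summable_doubleTerm <|
    mem_slitPlane_of_im_ne_zero (by simpa using hy)
  have s := (s1.sub s2).prod_symm
  rw [← s1.tsum_sub s2, ← (Equiv.prodComm ℕ ℕ).tsum_eq, ← tsum_mul_left]
  refine s.tsum_prod.trans (tsum_congr fun j => ?_)
  refine HasSum.tsum_eq ((s.prod_factor j).hasSum_iff_tendsto_nat.mpr ?_)
  have hlim := (tendsto_sum_range_shift hy (m := 3 * j + 1) (by positivity)).sub
    (tendsto_sum_range_shift hy (m := 3 * j + 2) (by positivity))
  rw [← mul_sub] at hlim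
  refine hlim.congr fun N => ?_
  rw [← Finset.sum_sub_distrib]
  refine Finset.sum_congr rfl fun k _ => ?_
  simp only [doubleTerm, Prod.swap]
  push_cast
  ring

open Complex in
lemma exp_third_pow_sub (n : ℕ) :
    exp (2 * π * I / 3) ^ n - exp (-(2 * π * I / 3)) ^ n = √3 * I * chi n := by
  have hcos : Real.cos (2 * π / 3) = -1 / 2 := by
    rw [show 2 * π / 3 = π - π / 3 by ring, Real.cos_pi_sub, Real.cos_pi_div_three]
    norm_num
  have hsin : Real.sin (2 * π / 3) = √3 / 2 := by
    rw [show 2 * π / 3 = π - π / 3 by ring, Real.sin_pi_sub, Real.sin_pi_div_three]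
  have h1 : exp (2 * π * I / 3) = -1 / 2 + √3 / 2 * I := by
    rw [show 2 * π * I / 3 = ((2 * π / 3 : ℝ) : ℂ) * I by push_cast; ring, exp_mul_I,
      ← ofReal_cos, ← ofReal_sin, hcos, hsin]
    push_cast
    ring
  have h2 : exp (-(2 * π * I / 3)) = -1 / 2 - √3 / 2 * I := by
    rw [show -(2 * π * I / 3) = ((-(2 * π / 3) : ℝ) : ℂ) * I by push_cast; ring, exp_mul_I,
      ← ofReal_cos, ← ofReal_sin, Real.cos_neg, Real.sin_neg, hcos, hsin]
    push_cast
    ring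
  have h3 : exp (2 * π * I / 3) ^ 3 = 1 := by
    rw [← exp_nat_mul, show ((3 : ℕ) : ℂ) * (2 * π * I / 3) = 2 * π * I by push_cast; ring,
      exp_two_pi_mul_I]
  have h4 : exp (-(2 * π * I / 3)) ^ 3 = 1 := by
    rw [exp_neg, inv_pow, h3, inv_one]
  have hs : ((√3 : ℝ) : ℂ) ^ 2 = 3 := by
    rw [← ofReal_pow, Real.sq_sqrt (by norm_num)]
    norm_num
  have hred : n = 3 * (n / 3) + n % 3 := (Nat.div_add_mod n 3).symm
  have hchi : chi n = if n % 3 = 1 then 1 else if n % 3 = 2 then -1 else 0 := by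
    unfold chi
    split_ifs <;> omega
  have hpow (x : ℂ) (hx : x ^ 3 = 1) : x ^ n = x ^ (n % 3) := by
    conv_lhs => rw [hred, pow_add, pow_mul, hx, one_pow, one_mul]
  rw [hpow _ h3, hpow _ h4, hchi, h1, h2]
  have : n % 3 < 3 := Nat.mod_lt _ (by norm_num)
  interval_cases n % 3
  · simp
  · simp
    ring
  · norm_num
    ring

open Complex Filter Topology in
lemma tsum_chi_mul_pow {z : ℂ} (hz : 0 < z.im) :
    ∑' n : ℕ, (chi n : ℂ) * exp (2 * π * I * z) ^ n =
      3 / (2 * π * √3) * ∑' j : ℕ, (doubleTerm z (0, j) + doubleTerm (-z) (0, j)) := by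
  have him (t : ℝ) : (z + t).im = z.im := by simp
  set x : UpperHalfPlane := ⟨z + (1 / 3 : ℝ), by rw [him]; exact hz⟩ with hx
  set x' : UpperHalfPlane := ⟨z + (-1 / 3 : ℝ), by rw [him]; exact hz⟩ with hx'
  have hxz : (x : ℂ) = z + 1 / 3 := by rw [hx]; simp
  have hxz' : (x' : ℂ) = z - 1 / 3 := by rw [hx']; simp; ring
  have hsum : Summable fun j : ℕ => doubleTerm z (0, j) + doubleTerm (-z) (0, j) :=
    ((summable_doubleTerm (mem_slitPlane_of_im_ne_zero hz.ne')).prod_factor 0).add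
      ((summable_doubleTerm (mem_slitPlane_of_im_ne_zero (by simpa using hz.ne'))).prod_factor 0)
  have hpart (N : ℕ) :
      3 * ∑ j ∈ Finset.range N, (doubleTerm z (0, j) + doubleTerm (-z) (0, j)) =
        (1 / (x : ℂ) + ∑ j ∈ Finset.range N, cotTerm x j) -
          (1 / (x' : ℂ) + ∑ j ∈ Finset.range N, cotTerm x' j) -
            (1 / ((x : ℂ) + N * 1) + 1 / (-(x' : ℂ) + N * 1)) := by
    induction N with
    | zero =>
      simp
      ring
    | succ N ih =>
      have e1 : (3 : ℂ) * N + 1 + 3 * (((0 : ℕ) + 1) * z) = 3 * (x + N) := by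
        rw [hxz]; push_cast; ring
      have e2 : (3 : ℂ) * N + 2 + 3 * (((0 : ℕ) + 1) * z) = 3 * (x' + (N + 1)) := by
        rw [hxz']; push_cast; ring
      have e3 : (3 : ℂ) * N + 1 + 3 * (((0 : ℕ) + 1) * -z) = -3 * (x' - N) := by
        rw [hxz']; push_cast; ring
      have e4 : (3 : ℂ) * N + 2 + 3 * (((0 : ℕ) + 1) * -z) = -3 * (x - (N + 1)) := by
        rw [hxz]; push_cast; ring
      have e5 : -(x' : ℂ) + N * 1 = -(x' - N) := by ring
      have e6 : -(x' : ℂ) + (N + 1 : ℕ) * 1 = -(x' - (N + 1)) := by push_cast; ring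
      rw [Finset.sum_range_succ, Finset.sum_range_succ, Finset.sum_range_succ, mul_add, ih, e5, e6]
      simp only [doubleTerm, cotTerm]
      rw [e1, e2, e3, e4]
      push_cast
      simp only [one_div, mul_inv, inv_neg]
      ring
  have hcot (w : UpperHalfPlane) :
      Tendsto (fun N => 1 / (w : ℂ) + ∑ j ∈ Finset.range N, cotTerm w j) atTop
        (𝓝 (π * cot (π * w))) := by
    simpa using (tendsto_logDeriv_euler_cot_sub
      (UpperHalfPlane.coe_mem_integerComplement w)).const_add (1 / (w : ℂ))
  have hlim : Tendsto (fun N : ℕ => 3 * ∑ j ∈ Finset.range N,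
      (doubleTerm z (0, j) + doubleTerm (-z) (0, j))) atTop
        (𝓝 (π * cot (π * x) - π * cot (π * x'))) := by
    simp only [hpart]
    simpa using ((hcot x).sub (hcot x')).sub
      ((tendsto_const_div_add_natCast_mul 1 (x : ℂ) one_ne_zero).add
        (tendsto_const_div_add_natCast_mul 1 (-(x' : ℂ)) one_ne_zero))
  have hq : π * cot (π * x) - π * cot (π * x') =
      2 * π * √3 * ∑' n : ℕ, (chi n : ℂ) * exp (2 * π * I * z) ^ n := by
    have hs (w : UpperHalfPlane) : Summable fun n : ℕ => exp (2 * π * I * w) ^ n :=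
      summable_geometric_of_norm_lt_one (UpperHalfPlane.norm_exp_two_pi_I_lt_one w)
    have hterm (n : ℕ) : exp (2 * π * I * x) ^ n - exp (2 * π * I * x') ^ n =
        √3 * I * ((chi n : ℂ) * exp (2 * π * I * z) ^ n) := by
      rw [hxz, hxz', show 2 * π * I * (z + 1 / 3) = 2 * π * I / 3 + 2 * π * I * z by ring,
        show 2 * π * I * (z - 1 / 3) = -(2 * π * I / 3) + 2 * π * I * z by ring, exp_add, exp_add,
        mul_pow, mul_pow, ← sub_mul, exp_third_pow_sub]
      ring
    have : ∑' n : ℕ, exp (2 * π * I * x) ^ n - ∑' n : ℕ, exp (2 * π * I * x') ^ n =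
        √3 * I * ∑' n : ℕ, (chi n : ℂ) * exp (2 * π * I * z) ^ n := by
      rw [← (hs x).tsum_sub (hs x'), ← tsum_mul_left]
      exact tsum_congr hterm
    rw [pi_mul_cot_pi_q_exp, pi_mul_cot_pi_q_exp]
    linear_combination (-2 * π * I) * this -
      2 * π * √3 * (∑' n : ℕ, (chi n : ℂ) * exp (2 * π * I * z) ^ n) * I_sq
  have huniq := tendsto_nhds_unique hlim (hsum.hasSum.tendsto_sum_nat.const_mul 3)
  rw [hq] at huniq
  have h3 : ((√3 : ℝ) : ℂ) ≠ 0 := by simp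
  have hpi : (π : ℂ) ≠ 0 := by simp
  field_simp
  linear_combination huniq

lemma chi_zero : chi 0 = 0 := by simp [chi]

lemma norm_chi_le (n : ℤ) : ‖(chi n : ℂ)‖ ≤ 1 := by
  unfold chi
  split_ifs <;> simp

open Complex in
lemma finf_eq_tsum_prod {y : ℂ} (hy : 0 < y.im) :
    finf y = 3 * ∑' k : ℕ, (∑' n : ℕ, (chi n : ℂ) * exp (2 * π * I * ((k + 1) * y)) ^ n) /
      (k + 1) := by
  set q := exp (2 * π * I * y) with hq
  have hq1 : ‖q‖ < 1 := UpperHalfPlane.norm_exp_two_pi_I_lt_one ⟨y, hy⟩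
  set F : ℕ+ × ℕ+ → ℂ := fun c => (chi c.2 : ℂ) / c.1 * q ^ (c.1 * c.2 : ℕ) with hF
  have hs : Summable F := by
    refine .of_norm_bounded (summable_prod_mul_pow 0 hq1).norm fun c => ?_
    simp only [hF, norm_mul, norm_div, pow_zero, one_mul]
    refine mul_le_of_le_one_left (norm_nonneg _) (div_le_one_of_le₀ ?_ (norm_nonneg _))
    rw [Complex.norm_natCast]
    exact (norm_chi_le _).trans (by exact_mod_cast (one_le : (1 : ℕ+) ≤ c.1))
  have hleft : finf y = 3 * ∑' c, F c := by
    have hs' := sigmaAntidiagonalEquivProd.summable_iff.mpr hs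
    rw [← sigmaAntidiagonalEquivProd.tsum_eq]
    change finf y = 3 * ∑' c, (F ∘ sigmaAntidiagonalEquivProd) c
    rw [hs'.tsum_sigma, ← tsum_mul_left, finf]
    have := tsum_pnat_eq_tsum_succ (f := fun n : ℕ => R n * exp (2 * π * I * n * y))
    push_cast at this
    rw [← this]
    refine tsum_congr fun n => ?_
    have hn : ((n : ℕ) : ℂ) ≠ 0 := by simp
    have hfib (c : (n : ℕ).divisorsAntidiagonal) :
        (F ∘ sigmaAntidiagonalEquivProd) ⟨n, c⟩ =
          (chi c.1.2 : ℂ) / c.1.1 * q ^ (c.1.1 * c.1.2) := rfl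
    simp only [hfib, tsum_fintype, Finset.univ_eq_attach]
    rw [(n : ℕ).divisorsAntidiagonal.sum_attach
        fun x : ℕ × ℕ => (chi x.2 : ℂ) / x.1 * q ^ (x.1 * x.2),
      Nat.sum_divisorsAntidiagonal' fun a b : ℕ => (chi b : ℂ) / a * q ^ (a * b), R, mul_assoc,
      Finset.sum_mul]
    congr 1
    refine Finset.sum_congr rfl fun d hd => ?_
    have hdn := Nat.dvd_of_mem_divisors hd
    have hd0 : (d : ℂ) ≠ 0 := by exact_mod_cast (Nat.pos_of_mem_divisors hd).ne'
    rw [Nat.div_mul_cancel hdn, Nat.cast_div hdn hd0, hq, ← exp_nat_mul,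
      show 2 * π * I * n * y = n * (2 * π * I * y) by ring]
    congr 1
    field_simp
  rw [hleft, hs.tsum_prod]
  congr 1
  have := tsum_pnat_eq_tsum_succ
    (f := fun k : ℕ => (∑' n : ℕ, (chi n : ℂ) * exp (2 * π * I * (k * y)) ^ n) / k)
  push_cast at this
  rw [← this]
  refine tsum_congr fun k => ?_
  have hk1 : ‖exp (2 * π * I * (k * y))‖ < 1 := by
    rw [show 2 * π * I * (k * y) = (k : ℕ) * (2 * π * I * y) by ring, exp_nat_mul, norm_pow]
    exact pow_lt_one₀ (norm_nonneg _) hq1 k.ne_zero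
  have hsk : Summable fun n : ℕ => (chi n : ℂ) * exp (2 * π * I * (k * y)) ^ n := by
    refine .of_norm_bounded (summable_geometric_of_norm_lt_one hk1).norm fun n => ?_
    rw [norm_mul]
    exact mul_le_of_le_one_left (norm_nonneg _) (norm_chi_le _)
  rw [← tsum_zero_pnat_eq_tsum_nat hsk, Nat.cast_zero, chi_zero, Int.cast_zero, zero_mul,
    zero_add, ← tsum_div_const]
  refine tsum_congr fun d => ?_
  rw [hF, show 2 * π * I * (k * y) = (k : ℕ) * (2 * π * I * y) by ring, exp_nat_mul, ← pow_mul]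
  ring

lemma doubleTerm_eq_div (w : ℂ) (k j : ℕ) :
    doubleTerm w (k, j) = doubleTerm ((k + 1) * w) (0, j) / (k + 1) := by
  simp [doubleTerm]

lemma finf_eq_doubleSum {y : ℂ} (hy : 0 < y.im) :
    finf y = 9 / (2 * π * √3) * (∑' p, doubleTerm y p + ∑' p, doubleTerm (-y) p) := by
  have s1 := summable_doubleTerm (mem_slitPlane_of_im_ne_zero hy.ne')
  have s2 := summable_doubleTerm (w := -y) (mem_slitPlane_of_im_ne_zero (by simpa using hy.ne'))
  rw [finf_eq_tsum_prod hy, ← s1.tsum_add s2, (s1.add s2).tsum_prod, ← tsum_mul_left,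
    ← tsum_mul_left]
  refine tsum_congr fun k => ?_
  have hk : 0 < (((k : ℂ) + 1) * y).im := by
    have : ((k : ℂ) + 1) * y = ((k + 1 : ℝ) : ℂ) * y := by push_cast; rfl
    rw [this, Complex.im_ofReal_mul]
    positivity
  rw [tsum_chi_mul_pow hk]
  simp only [doubleTerm_eq_div y k, doubleTerm_eq_div (-y) k, ← add_div, tsum_div_const, mul_neg]
  ring

/-- The generating function `f_∞` of the strong-coupling Stokes constants is a holomorphic
quantum modular function of weight zero for `Γ₁(3)`: the cocycle of `T = [[1,1],[0,1]]`
is trivial, and the cocycle of `γ₃ = [[1,0],[3,1]]` extends holomorphically to the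
cut plane `ℂ ∖ ℝ_{≤0} = Complex.slitPlane`. -/
theorem stmt17 :
    (∀ y : ℂ, 0 < y.im → finf (y + 1) = finf y) ∧
    ∃ h : ℂ → ℂ, DifferentiableOn ℂ h Complex.slitPlane ∧
      ∀ y : ℂ, 0 < y.im → h y = finf (y / (3 * y + 1)) - finf y := by
  refine ⟨fun y _ => tsum_congr fun n => ?_, fun y => 9 / (2 * π * √3) *
    (∑' p, doubleTerm (y / (3 * y + 1)) p - ∑' p, doubleTerm y p +
      3 * y * ∑' j, sectorTerm y j), ?_, fun y hy => ?_⟩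
  · rw [mul_add, Complex.exp_add, mul_one, mul_comm (2 * π * Complex.I),
      show ((n : ℂ) + 1) * (2 * π * Complex.I) = ((n + 1 : ℕ) : ℂ) * (2 * π * Complex.I) by
        push_cast; rfl, Complex.exp_nat_mul_two_pi_mul_I, mul_one]
  · have hne (y : ℂ) (hy : y ∈ Complex.slitPlane) : 3 * y + 1 ≠ 0 := by
      simpa [add_comm] using ofReal_add_mul_ne_zero hy one_pos (b := 3) (by norm_num)
    have hmaps : Set.MapsTo (fun y : ℂ => y / (3 * y + 1)) Complex.slitPlane
        Complex.slitPlane := by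
      intro y hy
      by_cases him : y.im = 0
      · obtain ⟨r, rfl⟩ : ∃ r : ℝ, (r : ℂ) = y := ⟨y.re, Complex.ext rfl (by simp [him])⟩
        have hr : 0 < r := by simpa using hy
        have : (r : ℂ) / (3 * r + 1) = ((r / (3 * r + 1) : ℝ) : ℂ) := by push_cast; rfl
        simp only [this, Complex.ofReal_mem_slitPlane]
        positivity
      · exact mem_slitPlane_of_im_ne_zero (im_div_three_mul_add_one_ne_zero him)
    have hmob : DifferentiableOn ℂ (fun y : ℂ => y / (3 * y + 1)) Complex.slitPlane :=
      differentiableOn_id.div (by fun_prop) hne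
    have hlin : DifferentiableOn ℂ (fun y : ℂ => 3 * y) Complex.slitPlane := by fun_prop
    exact (((differentiableOn_tsum_doubleTerm.comp hmob hmaps).sub
      differentiableOn_tsum_doubleTerm).add
        (hlin.mul differentiableOn_tsum_sectorTerm)).const_mul _
  · have him : 0 < (y / (3 * y + 1)).im := by
      rw [im_div_three_mul_add_one]
      exact div_pos hy (Complex.normSq_pos.mpr
        (by simpa [add_comm] using add_mul_ne_zero_of_im_ne_zero hy.ne' one_ne_zero 3))
    rw [finf_eq_doubleSum hy, finf_eq_doubleSum him]
    linear_combination (-9 / (2 * π * √3)) * tsum_doubleTerm_neg_sub hy.ne'
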